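/- arXiv:2305.17140 — 3 statements merged into one kernel-verified Lean document; each statement's English description precedes it below -/
import Mathlib

section
/- If (S_obs, S_dec) is a consistent state in which every relevant symbol (environmental or decision) is interpreted, then (S_obs, S_dec) is itself a definite state. (Proposition 1 of the paper.) -/
/-- A partial structure assigns an optional Boolean value to each symbol. -/
abbrev PartialStruct (α : Type*) := α → Option Bool

/-- A total structure assigns a Boolean value to each symbol. -/
abbrev TotalStruct (α : Type*) := α → Bool

/-- `Lep S S'` : `S` is less precise than `S'`. -/
def Lep {α : Type*} (S S' : PartialStruct α) : Prop :=
  ∀ σ v, S σ = some v → S' σ = some v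

/-- `Expands M S` : the total structure `M` is a total expansion of `S`. -/
def Expands {α : Type*} (M : TotalStruct α) (S : PartialStruct α) : Prop :=
  ∀ σ v, S σ = some v → M σ = v

section States
variable {ε δ : Type*}

/-- A state is consistent if some joint total expansion is a model of both theories. -/
def Consistent (Tenv : Set (TotalStruct ε)) (Tsol : Set (TotalStruct ε × TotalStruct δ))
    (Sobs : PartialStruct ε) (Sdec : PartialStruct δ) : Prop :=
  ∃ So Sd, Expands So Sobs ∧ Expands Sd Sdec ∧ So ∈ Tenv ∧ (So, Sd) ∈ Tsol

/-- A definite state. -/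
def Definite (Tenv : Set (TotalStruct ε)) (Tsol : Set (TotalStruct ε × TotalStruct δ))
    (Sobs : PartialStruct ε) (Sdec : PartialStruct δ) : Prop :=
  ∀ So, Expands So Sobs → So ∈ Tenv → ∀ Sd, Expands Sd Sdec → (So, Sd) ∈ Tsol

/-- A contingent state. -/
def Contingent (Tenv : Set (TotalStruct ε)) (Tsol : Set (TotalStruct ε × TotalStruct δ))
    (Sobs : PartialStruct ε) (Sdec : PartialStruct δ) : Prop :=
  ∀ So, Expands So Sobs → So ∈ Tenv → ∃ Sd, Expands Sd Sdec ∧ (So, Sd) ∈ Tsol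

end States

section Minimal
variable {ε δ : Type*}

/-- The set of `≤ₚ`-minimal definite states expanding a given state. -/
def MinDef (Tenv : Set (TotalStruct ε)) (Tsol : Set (TotalStruct ε × TotalStruct δ))
    (Sobs : PartialStruct ε) (Sdec : PartialStruct δ) :
    Set (PartialStruct ε × PartialStruct δ) :=
  {p | Definite Tenv Tsol p.1 p.2 ∧ Lep Sobs p.1 ∧ Lep Sdec p.2 ∧
       ∀ q : PartialStruct ε × PartialStruct δ,
         Definite Tenv Tsol q.1 q.2 → Lep Sobs q.1 → Lep Sdec q.2 →
         Lep q.1 p.1 → Lep q.2 p.2 → q = p}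

/-- The set of `≤ₚ`-minimal contingent states expanding a given state. -/
def MinCont (Tenv : Set (TotalStruct ε)) (Tsol : Set (TotalStruct ε × TotalStruct δ))
    (Sobs : PartialStruct ε) (Sdec : PartialStruct δ) :
    Set (PartialStruct ε × PartialStruct δ) :=
  {p | Contingent Tenv Tsol p.1 p.2 ∧ Lep Sobs p.1 ∧ Lep Sdec p.2 ∧
       ∀ q : PartialStruct ε × PartialStruct δ,
         Contingent Tenv Tsol q.1 q.2 → Lep Sobs q.1 → Lep Sdec q.2 →
         Lep q.1 p.1 → Lep q.2 p.2 → q = p}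

end Minimal

theorem Lep.trans {α : Type*} {S T U : PartialStruct α} (h : Lep S T) (h' : Lep T U) :
    Lep S U := fun σ v hv => h' σ v (h σ v hv)

theorem Lep.eq_of_isSome {α : Type*} {S T : PartialStruct α} (h : Lep S T)
    (h' : ∀ σ, (T σ).isSome → (S σ).isSome) : S = T := by
  funext σ
  cases hS : S σ with
  | some v => exact (h σ v hS).symm
  | none =>
    cases hT : T σ with
    | none => rfl
    | some v =>
      have := h' σ (by simp [hT])
      simp [hS] at this

theorem Lep.antisymm {α : Type*} {S T : PartialStruct α} (h : Lep S T) (h' : Lep T S) :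
    S = T := by
  refine h.eq_of_isSome fun σ hσ => ?_
  obtain ⟨v, hv⟩ := Option.isSome_iff_exists.1 hσ
  simp [h' σ v hv]

theorem Expands.lep_some {α : Type*} {M : TotalStruct α} {S : PartialStruct α}
    (h : Expands M S) : Lep S (fun σ => some (M σ)) :=
  fun σ v hv => congrArg some (h σ v hv)

theorem Expands.eq_of_some {α : Type*} {M N : TotalStruct α}
    (h : Expands M (fun σ => some (N σ))) : M = N :=
  funext fun σ => h σ (N σ) rfl

/-- Strict precision order on pairs of partial structures. -/
def StateLt {ε δ : Type*} (p q : PartialStruct ε × PartialStruct δ) : Prop :=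
  Lep p.1 q.1 ∧ Lep p.2 q.2 ∧ p ≠ q

theorem wellFounded_stateLt {ε δ : Type*} [Finite ε] [Finite δ] :
    WellFounded (StateLt (ε := ε) (δ := δ)) := by
  have : IsTrans (PartialStruct ε × PartialStruct δ) StateLt := ⟨by
    rintro a b c ⟨h₁, h₂, h₃⟩ ⟨k₁, k₂, -⟩
    refine ⟨h₁.trans k₁, h₂.trans k₂, ?_⟩
    rintro rfl
    exact h₃ (Prod.ext (h₁.antisymm k₁) (h₂.antisymm k₂))⟩
  have : Std.Irrefl (StateLt (ε := ε) (δ := δ)) := ⟨fun _ h => h.2.2 rfl⟩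
  exact Finite.wellFounded_of_trans_of_irrefl _

theorem Consistent.minDef_nonempty {ε δ : Type*} [Finite ε] [Finite δ]
    {Tenv : Set (TotalStruct ε)} {Tsol : Set (TotalStruct ε × TotalStruct δ)}
    {Sobs : PartialStruct ε} {Sdec : PartialStruct δ}
    (h : Consistent Tenv Tsol Sobs Sdec) : (MinDef Tenv Tsol Sobs Sdec).Nonempty := by
  obtain ⟨So, Sd, hSo, hSd, -, hsol⟩ := h
  obtain ⟨p, ⟨hp, hp₁, hp₂⟩, hmin⟩ := wellFounded_stateLt.has_min
    {p : PartialStruct ε × PartialStruct δ |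
      Definite Tenv Tsol p.1 p.2 ∧ Lep Sobs p.1 ∧ Lep Sdec p.2}
    ⟨(fun σ => some (So σ), fun σ => some (Sd σ)), by
      refine ⟨fun M hM _ N hN => ?_, hSo.lep_some, hSd.lep_some⟩
      rwa [hM.eq_of_some, hN.eq_of_some]⟩
  refine ⟨p, hp, hp₁, hp₂, fun q hq hq₁ hq₂ hqp₁ hqp₂ => ?_⟩
  by_contra hne
  exact hmin q ⟨hq, hq₁, hq₂⟩ ⟨hqp₁, hqp₂, hne⟩

/-- Proposition 1: a consistent state in which every relevant symbol (environmental
or decision) is interpreted is a definite state. -/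
theorem stmt_0 {ε δ : Type*} [Fintype ε] [Fintype δ]
    (Tenv : Set (TotalStruct ε)) (Tsol : Set (TotalStruct ε × TotalStruct δ))
    (Sobs : PartialStruct ε) (Sdec : PartialStruct δ)
    (hcons : Consistent Tenv Tsol Sobs Sdec)
    (henv : ∀ σ : ε, (∃ p ∈ MinDef Tenv Tsol Sobs Sdec, (p.1 σ).isSome) → (Sobs σ).isSome)
    (hdec : ∀ σ : δ, (∃ p ∈ MinDef Tenv Tsol Sobs Sdec, (p.2 σ).isSome) → (Sdec σ).isSome) :
    Definite Tenv Tsol Sobs Sdec := by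
  obtain ⟨p, hp⟩ := hcons.minDef_nonempty
  have h₁ : Sobs = p.1 := hp.2.1.eq_of_isSome fun σ hσ => henv σ ⟨p, hp, hσ⟩
  have h₂ : Sdec = p.2 := hp.2.2.1.eq_of_isSome fun σ hσ => hdec σ ⟨p, hp, hσ⟩
  rw [h₁, h₂]
  exact hp.1
end

section
/- If (S_obs, S_dec) is a consistent state in which every relevant environmental symbol is interpreted, then (S_obs, S_dec) is a contingent state, where a symbol is here called relevant if it is interpreted in some ≤_p-minimal contingent state expanding the state. (Proposition 2 of the paper.) -/
theorem Expands.mono {α : Type*} {M : TotalStruct α} {S T : PartialStruct α}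
    (hM : Expands M T) (h : Lep S T) : Expands M S := fun σ v hv => hM σ v (h σ v hv)

/-- A structure equals any more precise one that interprets no further symbols. -/
theorem Lep.eq_of_isSome_imp {α : Type*} {S T : PartialStruct α} (h : Lep S T)
    (hT : ∀ σ, (T σ).isSome → (S σ).isSome) : S = T := by
  refine h.antisymm fun σ v hv => ?_
  obtain ⟨w, hw⟩ := Option.isSome_iff_exists.mp (hT σ (by simp [hv]))
  rwa [hw, ← h σ w hw]

/-- A consistent state has a contingent expansion. -/
theorem Consistent.exists_contingent {ε δ : Type*} {Tenv : Set (TotalStruct ε)}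
    {Tsol : Set (TotalStruct ε × TotalStruct δ)} {Sobs : PartialStruct ε}
    {Sdec : PartialStruct δ} (h : Consistent Tenv Tsol Sobs Sdec) :
    ∃ p : PartialStruct ε × PartialStruct δ,
      Contingent Tenv Tsol p.1 p.2 ∧ Lep Sobs p.1 ∧ Lep Sdec p.2 := by
  obtain ⟨So, Sd, ho, hd, -, hsol⟩ := h
  refine ⟨(fun σ => some (So σ), fun σ => some (Sd σ)), fun M hM _ => ⟨Sd, ?_, ?_⟩,
    fun σ v hv => congrArg some (ho σ v hv), fun σ v hv => congrArg some (hd σ v hv)⟩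
  · exact fun σ v hv => Option.some.inj hv
  · obtain rfl : M = So := funext fun σ => hM σ _ rfl
    exact hsol

/-- A consistent state has a minimal contingent expansion. -/
theorem Consistent.minCont_nonempty {ε δ : Type*} [Finite ε] [Finite δ]
    {Tenv : Set (TotalStruct ε)} {Tsol : Set (TotalStruct ε × TotalStruct δ)}
    {Sobs : PartialStruct ε} {Sdec : PartialStruct δ} (h : Consistent Tenv Tsol Sobs Sdec) :
    (MinCont Tenv Tsol Sobs Sdec).Nonempty := by
  let r : PartialStruct ε × PartialStruct δ → PartialStruct ε × PartialStruct δ → Prop :=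
    fun p q => (Lep p.1 q.1 ∧ Lep p.2 q.2) ∧ p ≠ q
  have : IsTrans _ r := ⟨by
    rintro p q s ⟨⟨h1, h2⟩, hne⟩ ⟨⟨h3, h4⟩, -⟩
    refine ⟨⟨h1.trans h3, h2.trans h4⟩, ?_⟩
    rintro rfl
    exact hne (Prod.ext (h1.antisymm h3) (h2.antisymm h4))⟩
  have : Std.Irrefl r := ⟨fun p hp => hp.2 rfl⟩
  have wf : WellFounded r := Finite.wellFounded_of_trans_of_irrefl r
  obtain ⟨p, ⟨hc, ho, hd⟩, hmin⟩ := wf.has_min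
    {p | Contingent Tenv Tsol p.1 p.2 ∧ Lep Sobs p.1 ∧ Lep Sdec p.2} h.exists_contingent
  exact ⟨p, hc, ho, hd, fun q hqc hqo hqd h1 h2 =>
    by_contra fun hne => hmin q ⟨hqc, hqo, hqd⟩ ⟨⟨h1, h2⟩, hne⟩⟩

/-- Proposition 2: a consistent state in which every relevant environmental symbol
(w.r.t. minimal contingent expansions) is interpreted is a contingent state. -/
theorem stmt_1 {ε δ : Type*} [Fintype ε] [Fintype δ]
    (Tenv : Set (TotalStruct ε)) (Tsol : Set (TotalStruct ε × TotalStruct δ))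
    (Sobs : PartialStruct ε) (Sdec : PartialStruct δ)
    (hcons : Consistent Tenv Tsol Sobs Sdec)
    (henv : ∀ σ : ε, (∃ p ∈ MinCont Tenv Tsol Sobs Sdec, (p.1 σ).isSome) → (Sobs σ).isSome) :
    Contingent Tenv Tsol Sobs Sdec := by
  obtain ⟨p, hp⟩ := hcons.minCont_nonempty
  have heq : Sobs = p.1 := hp.2.1.eq_of_isSome_imp fun σ hσ => henv σ ⟨p, hp, hσ⟩
  intro So hSo hmem
  obtain ⟨Sd, hSd, hsol⟩ := hp.1 So (heq ▸ hSo) hmem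
  exact ⟨Sd, hSd.mono hp.2.2.1, hsol⟩
end

section
/- Symbols on which the theories do not depend are irrelevant: let (S_obs, S_dec) be a state and σ ∈ ε an environmental symbol not interpreted in S_obs. Suppose T_env and T_sol are independent of σ, i.e., for any two total structures S_o, S_o' over ε that agree on all symbols except possibly σ, S_o ∈ T_env ↔ S_o' ∈ T_env, and for every total structure S_d over δ, (S_o, S_d) ∈ T_sol ↔ (S_o', S_d) ∈ T_sol. Then σ is not relevant in (S_obs, S_dec): no ≤_p-minimal definite state expanding (S_obs, S_dec) interprets σ. -/
/-- If the theories do not depend on `σ₀`, forgetting the value of `σ₀` preserves definiteness. -/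
theorem Definite.update_none {ε δ : Type*} [DecidableEq ε]
    {Tenv : Set (TotalStruct ε)} {Tsol : Set (TotalStruct ε × TotalStruct δ)}
    {Sobs : PartialStruct ε} {Sdec : PartialStruct δ} (h : Definite Tenv Tsol Sobs Sdec) {σ₀ : ε}
    (hindep : ∀ So So' : TotalStruct ε, (∀ τ, τ ≠ σ₀ → So τ = So' τ) →
      ((So ∈ Tenv ↔ So' ∈ Tenv) ∧
       ∀ Sd : TotalStruct δ, ((So, Sd) ∈ Tsol ↔ (So', Sd) ∈ Tsol))) :
    Definite Tenv Tsol (Function.update Sobs σ₀ none) Sdec := by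
  intro So hSo hE Sd hSd
  obtain ⟨henv, hsol⟩ := hindep So (Function.update So σ₀ ((Sobs σ₀).getD false))
    fun τ hτ => by rw [Function.update_of_ne hτ]
  refine (hsol Sd).2 (h _ ?_ (henv.1 hE) Sd hSd)
  intro τ v hv
  by_cases hτ : τ = σ₀
  · subst hτ
    simp [hv]
  · rw [Function.update_of_ne hτ]
    exact hSo τ v (by rwa [Function.update_of_ne hτ])

/-- Symbols on which the theories do not depend are irrelevant. -/
theorem stmt_7 {ε δ : Type*} [Fintype ε] [Fintype δ]
    (Tenv : Set (TotalStruct ε)) (Tsol : Set (TotalStruct ε × TotalStruct δ))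
    (Sobs : PartialStruct ε) (Sdec : PartialStruct δ)
    (σ₀ : ε) (hnotint : Sobs σ₀ = none)
    (hindep : ∀ So So' : TotalStruct ε, (∀ τ, τ ≠ σ₀ → So τ = So' τ) →
      ((So ∈ Tenv ↔ So' ∈ Tenv) ∧
       ∀ Sd : TotalStruct δ, ((So, Sd) ∈ Tsol ↔ (So', Sd) ∈ Tsol))) :
    ∀ p ∈ MinDef Tenv Tsol Sobs Sdec, p.1 σ₀ = none := by
  classical
  rintro ⟨So, Sd⟩ ⟨hdef, hobs, hdec, hmin⟩
  have heq := hmin (Function.update So σ₀ none, Sd) (hdef.update_none hindep) ?_ hdec ?_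
    fun _ _ h => h
  · rw [← heq]
    simp
  · intro τ v hv
    have hτ : τ ≠ σ₀ := by
      rintro rfl
      simp [hnotint] at hv
    simpa [Function.update_of_ne hτ] using hobs τ v hv
  · intro τ v hv
    by_cases hτ : τ = σ₀
    · simp [hτ] at hv
    · simpa [Function.update_of_ne hτ] using hv
end
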